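/- arXiv:2304.12073 — 3 statements merged into one kernel-verified Lean document; each statement's English description precedes it below -/
import Mathlib

section
/- Let K_{r_1,…,r_k} be a complete multipartite graph with k ≥ 3 parts, smallest part of size r_k = 2, no part of size exactly 3 (r_j ≠ 3 for all j), and an odd total number of vertices n = r_1 + … + r_k. Then the game chromatic number satisfies χ_g(K_{r_1,…,r_k}) = min{2k − 1, Σ_{i=1}^{k} ⌈r_i/2⌉}. -/
/-- A color `c` is legal for vertex `v` in partial coloring `f` if no neighbor of `v`
is already colored with `c`. -/
def legalColor {V C : Type} (G : SimpleGraph V) (f : V → Option C) (v : V) (c : C) : Prop :=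
  ∀ w, G.Adj v w → f w ≠ some c

/-- A move in the coloring game: choose an uncolored vertex and color it with a legal color. -/
def gameMove {V C : Type} [DecidableEq V] (G : SimpleGraph V) (f f' : V → Option C) : Prop :=
  ∃ v c, f v = none ∧ legalColor G f v c ∧ f' = Function.update f v (some c)

/-- Every vertex is colored. -/
def isFull {V C : Type} (f : V → Option C) : Prop := ∀ v, (f v).isSome

/-- Some uncolored vertex has no legal color (then Bob wins). -/
def isStuck {V C : Type} (G : SimpleGraph V) (f : V → Option C) : Prop :=
  ∃ v, f v = none ∧ ∀ c, ¬ legalColor G f v c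

/-- It is Alice's turn when an even number of vertices are colored
(Alice moves first, and each move colors exactly one vertex). -/
def aliceTurn {V C : Type} [Fintype V] (f : V → Option C) : Prop :=
  Even (Finset.univ.filter (fun v => (f v).isSome = true)).card

/-- Alice has a winning strategy from position `f` when `n` vertices remain uncolored:
Alice wins exactly the plays in which the entire graph gets colored; as soon as some
uncolored vertex has no legal color, Bob wins. -/
def aliceWinsFrom {V C : Type} [Fintype V] [DecidableEq V] (G : SimpleGraph V) :
    ℕ → (V → Option C) → Prop
  | 0, f => isFull f
  | n + 1, f => isFull f ∨ (¬ isStuck G f ∧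
      ((aliceTurn f ∧ ∃ f', gameMove G f f' ∧ aliceWinsFrom G n f') ∨
       (¬ aliceTurn f ∧ ∀ f', gameMove G f f' → aliceWinsFrom G n f')))

/-- Alice has a winning strategy in the graph coloring game on `G` with `m` colors. -/
def aliceWins {V : Type} [Fintype V] [DecidableEq V] (G : SimpleGraph V) (m : ℕ) : Prop :=
  aliceWinsFrom (C := Fin m) G (Fintype.card V) (fun _ => none)

/-- The game chromatic number: the least number of colors for which Alice has
a winning strategy. -/
noncomputable def gameChromaticNumber {V : Type} [Fintype V] [DecidableEq V]
    (G : SimpleGraph V) : ℕ :=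
  sInf {m | aliceWins G m}

/-- The complete multipartite graph `K_{r 0, …, r (k-1)}`. -/
def K (k : ℕ) (r : Fin k → ℕ) : SimpleGraph (Σ i : Fin k, Fin (r i)) :=
  SimpleGraph.completeMultipartiteGraph (fun i => Fin (r i))

namespace MultipartiteGame

open Finset

/-- The data of a position of the coloring game on a complete multipartite graph that decide
the outcome: the number `free` of unused colors, the number `loose` of uncolored vertices in
parts which already contain a colored vertex, and the set `fresh` of wholly uncolored parts. -/
@[ext] structure Summary (k : ℕ) where
  free : ℕ
  loose : ℕ
  fresh : Finset (Fin k)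

/-- The effect of a single move on the summary of a position. -/
inductive Step {k : ℕ} (r : Fin k → ℕ) : Summary k → Summary k → Prop
  | reuse (F T : ℕ) (U : Finset (Fin k)) : Step r ⟨F, T + 1, U⟩ ⟨F, T, U⟩
  | spend (F T : ℕ) (U : Finset (Fin k)) : Step r ⟨F + 1, T + 1, U⟩ ⟨F, T, U⟩
  | touch (F T T' : ℕ) (U : Finset (Fin k)) (i : Fin k) (hi : i ∈ U) (hT : T' + 1 = T + r i) :
      Step r ⟨F + 1, T, U⟩ ⟨F, T', U.erase i⟩

/-- The number of uncolored vertices. -/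
def Summary.size {k : ℕ} (r : Fin k → ℕ) (s : Summary k) : ℕ := s.loose + ∑ i ∈ s.fresh, r i

/-- The number of colors that suffices for Alice when she answers Bob by pairing vertices. -/
def Summary.potential {k : ℕ} (r : Fin k → ℕ) (s : Summary k) : ℕ :=
  (s.loose + 1) / 2 + ∑ i ∈ s.fresh, (r i + 1) / 2

section Concrete

variable {k m : ℕ} {r : Fin k → ℕ}

/-- The parts without colored vertices. -/
def freshParts (f : (Σ i : Fin k, Fin (r i)) → Option (Fin m)) : Finset (Fin k) :=
  univ.filter fun i => ∀ j, f ⟨i, j⟩ = none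

/-- The colors not used so far. -/
def freeColors (f : (Σ i : Fin k, Fin (r i)) → Option (Fin m)) : Finset (Fin m) :=
  univ.filter fun c => ∀ v, f v ≠ some c

/-- The summary of a position. -/
def summary (f : (Σ i : Fin k, Fin (r i)) → Option (Fin m)) : Summary k where
  free := (freeColors f).card
  loose := (univ.filter fun v => f v = none ∧ v.1 ∉ freshParts f).card
  fresh := freshParts f

/-- No color occurs in two different parts. -/
def IsProper (f : (Σ i : Fin k, Fin (r i)) → Option (Fin m)) : Prop :=
  ∀ v w c, f v = some c → f w = some c → v.1 = w.1

lemma K_adj (v w : Σ i : Fin k, Fin (r i)) : (K k r).Adj v w ↔ v.1 ≠ w.1 := Iff.rfl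

lemma size_summary (f : (Σ i : Fin k, Fin (r i)) → Option (Fin m)) :
    (summary f).size r = (univ.filter fun v => f v = none).card := by
  have h : ∑ i ∈ freshParts f, r i =
      (univ.filter fun v => f v = none ∧ v.1 ∈ freshParts f).card := by
    have e : (univ.filter fun v => f v = none ∧ v.1 ∈ freshParts f) =
        (freshParts f).sigma fun _ => univ := by
      ext ⟨i, j⟩
      simp only [freshParts, mem_filter, mem_univ, true_and, mem_sigma, and_true]
      exact ⟨fun h => h.2, fun h => ⟨h j, h⟩⟩
    rw [e, card_sigma]
    simp
  have h2 := card_filter_add_card_filter_not (s := univ.filter fun v => f v = none)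
    (fun v => v.1 ∈ freshParts f)
  rw [filter_filter, filter_filter] at h2
  simp only [Summary.size, summary]
  omega

lemma freshParts_update (f : (Σ i : Fin k, Fin (r i)) → Option (Fin m))
    (v : Σ i : Fin k, Fin (r i)) (c : Fin m) :
    freshParts (Function.update f v (some c)) = (freshParts f).erase v.1 := by
  obtain ⟨i, j⟩ := v
  ext a
  simp only [freshParts, mem_filter, mem_univ, true_and, mem_erase]
  constructor
  · intro h
    have hne : a ≠ i := by
      rintro rfl
      simpa using h j
    refine ⟨hne, fun b => ?_⟩
    have := h b
    rwa [Function.update_of_ne (by rintro ⟨⟩; exact hne rfl)] at this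
  · rintro ⟨hne, h⟩ b
    rw [Function.update_of_ne (by rintro ⟨⟩; exact hne rfl)]
    exact h b

lemma freeColors_update (f : (Σ i : Fin k, Fin (r i)) → Option (Fin m))
    {v : Σ i : Fin k, Fin (r i)} (hv : f v = none) (c : Fin m) :
    freeColors (Function.update f v (some c)) = (freeColors f).erase c := by
  ext d
  simp only [freeColors, mem_filter, mem_univ, true_and, mem_erase]
  constructor
  · intro h
    refine ⟨fun e => h v (by simp [e]), fun w => ?_⟩
    by_cases hw : w = v
    · simp [hw, hv]
    · simpa [Function.update_of_ne hw] using h w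
  · rintro ⟨hne, h⟩ w
    by_cases hw : w = v
    · subst hw
      simpa using fun e => hne e.symm
    · simpa [Function.update_of_ne hw] using h w

lemma size_update (f : (Σ i : Fin k, Fin (r i)) → Option (Fin m))
    {v : Σ i : Fin k, Fin (r i)} (hv : f v = none) (c : Fin m) :
    (summary (Function.update f v (some c))).size r + 1 = (summary f).size r := by
  rw [size_summary, size_summary]
  have e : (univ.filter fun w => Function.update f v (some c) w = none) =
      (univ.filter fun w => f w = none).erase v := by
    ext w
    by_cases hw : w = v
    · simp [hw]
    · simp [hw]
  rw [e, card_erase_add_one (by simpa using hv)]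

lemma IsProper.update {f : (Σ i : Fin k, Fin (r i)) → Option (Fin m)} (hf : IsProper f)
    {v : Σ i : Fin k, Fin (r i)} {c : Fin m} (hc : legalColor (K k r) f v c) :
    IsProper (Function.update f v (some c)) := by
  have key : ∀ w, f w = some c → v.1 = w.1 := fun w hw => by
    by_contra hne
    exact hc w ((K_adj v w).2 hne) hw
  intro a b d ha hb
  by_cases hav : a = v <;> by_cases hbv : b = v
  · rw [hav, hbv]
  · subst hav
    rw [Function.update_self] at ha
    rw [Function.update_of_ne hbv] at hb
    exact key b (hb.trans ha.symm)
  · subst hbv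
    rw [Function.update_self] at hb
    rw [Function.update_of_ne hav] at ha
    exact (key a (ha.trans hb.symm)).symm
  · rw [Function.update_of_ne hav] at ha
    rw [Function.update_of_ne hbv] at hb
    exact hf a b d ha hb

lemma IsProper.of_gameMove {f f' : (Σ i : Fin k, Fin (r i)) → Option (Fin m)} (hf : IsProper f)
    (h : gameMove (K k r) f f') : IsProper f' := by
  obtain ⟨v, c, -, hc, rfl⟩ := h
  exact hf.update hc

lemma legalColor_of_mem_freeColors {f : (Σ i : Fin k, Fin (r i)) → Option (Fin m)} {c : Fin m}
    (hc : c ∈ freeColors f) (v : Σ i : Fin k, Fin (r i)) : legalColor (K k r) f v c := by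
  simp only [freeColors, mem_filter, mem_univ, true_and] at hc
  exact fun w _ => hc w

lemma exists_used_legalColor {f : (Σ i : Fin k, Fin (r i)) → Option (Fin m)} (hf : IsProper f)
    {v : Σ i : Fin k, Fin (r i)} (hv : v.1 ∉ freshParts f) :
    ∃ c, c ∉ freeColors f ∧ legalColor (K k r) f v c := by
  simp only [freshParts, mem_filter, mem_univ, true_and, not_forall] at hv
  obtain ⟨j, hj⟩ := hv
  obtain ⟨c, hc⟩ := Option.ne_none_iff_exists'.1 hj
  refine ⟨c, ?_, fun w hw hwc => (K_adj v w).1 hw (hf ⟨v.1, j⟩ w c hc hwc)⟩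
  simp only [freeColors, mem_filter, mem_univ, true_and, not_forall, not_not]
  exact ⟨_, hc⟩

lemma mem_freeColors_of_legalColor {f : (Σ i : Fin k, Fin (r i)) → Option (Fin m)}
    {v : Σ i : Fin k, Fin (r i)} {c : Fin m} (hc : legalColor (K k r) f v c)
    (hv : v.1 ∈ freshParts f) : c ∈ freeColors f := by
  simp only [freshParts, mem_filter, mem_univ, true_and] at hv
  simp only [freeColors, mem_filter, mem_univ, true_and]
  intro w hw
  by_cases h : v.1 = w.1
  · obtain ⟨a, b⟩ := v
    obtain ⟨a', b'⟩ := w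
    cases h
    simp [hv b'] at hw
  · exact hc w ((K_adj v w).2 h) hw

lemma summary_update_spend {f : (Σ i : Fin k, Fin (r i)) → Option (Fin m)}
    {v : Σ i : Fin k, Fin (r i)} (hv : f v = none) {c : Fin m}
    (hfresh : v.1 ∉ freshParts f) (hc : c ∈ freeColors f) :
    (summary (Function.update f v (some c))).free + 1 = (summary f).free ∧
    (summary (Function.update f v (some c))).loose + 1 = (summary f).loose ∧
    (summary (Function.update f v (some c))).fresh = (summary f).fresh := by
  have hs := size_update f hv c
  have hU : (summary (Function.update f v (some c))).fresh = (summary f).fresh :=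
    (freshParts_update f v c).trans (erase_eq_of_notMem hfresh)
  refine ⟨?_, ?_, hU⟩
  · simp only [summary]
    rw [freeColors_update f hv, card_erase_add_one hc]
  · simp only [Summary.size] at hs
    rw [hU] at hs
    omega

lemma summary_update_reuse {f : (Σ i : Fin k, Fin (r i)) → Option (Fin m)}
    {v : Σ i : Fin k, Fin (r i)} (hv : f v = none) {c : Fin m}
    (hfresh : v.1 ∉ freshParts f) (hc : c ∉ freeColors f) :
    (summary (Function.update f v (some c))).free = (summary f).free ∧
    (summary (Function.update f v (some c))).loose + 1 = (summary f).loose ∧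
    (summary (Function.update f v (some c))).fresh = (summary f).fresh := by
  have hs := size_update f hv c
  have hU : (summary (Function.update f v (some c))).fresh = (summary f).fresh :=
    (freshParts_update f v c).trans (erase_eq_of_notMem hfresh)
  refine ⟨?_, ?_, hU⟩
  · simp only [summary]
    rw [freeColors_update f hv, erase_eq_of_notMem hc]
  · simp only [Summary.size] at hs
    rw [hU] at hs
    omega

lemma summary_update_touch {f : (Σ i : Fin k, Fin (r i)) → Option (Fin m)}
    {v : Σ i : Fin k, Fin (r i)} (hv : f v = none) {c : Fin m}
    (hfresh : v.1 ∈ freshParts f) (hc : c ∈ freeColors f) :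
    (summary (Function.update f v (some c))).free + 1 = (summary f).free ∧
    (summary (Function.update f v (some c))).loose + 1 = (summary f).loose + r v.1 ∧
    (summary (Function.update f v (some c))).fresh = (summary f).fresh.erase v.1 := by
  have hs := size_update f hv c
  have hU : (summary (Function.update f v (some c))).fresh = (summary f).fresh.erase v.1 :=
    freshParts_update f v c
  refine ⟨?_, ?_, hU⟩
  · simp only [summary]
    rw [freeColors_update f hv, card_erase_add_one hc]
  · simp only [Summary.size] at hs
    rw [hU] at hs
    have := add_sum_erase (summary f).fresh r hfresh
    omega

lemma step_of_gameMove {f f' : (Σ i : Fin k, Fin (r i)) → Option (Fin m)}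
    (h : gameMove (K k r) f f') : Step r (summary f) (summary f') := by
  obtain ⟨v, c, hv, hc, rfl⟩ := h
  generalize hs' : summary (Function.update f v (some c)) = s'
  generalize hs : summary f = s
  by_cases hfresh : v.1 ∈ freshParts f
  · obtain ⟨h1, h2, h3⟩ :=
      summary_update_touch hv hfresh (mem_freeColors_of_legalColor hc hfresh)
    have hmem : v.1 ∈ (summary f).fresh := hfresh
    rw [hs', hs] at h1 h2 h3
    rw [hs] at hmem
    obtain ⟨F, T, U⟩ := s
    obtain ⟨F', T', U'⟩ := s'
    dsimp only at h1 h2 h3 hmem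
    subst h1 h3
    exact Step.touch _ _ _ _ _ hmem h2
  · by_cases hfree : c ∈ freeColors f
    · obtain ⟨h1, h2, h3⟩ := summary_update_spend hv hfresh hfree
      rw [hs', hs] at h1 h2 h3
      obtain ⟨F, T, U⟩ := s
      obtain ⟨F', T', U'⟩ := s'
      dsimp only at h1 h2 h3
      subst h1 h2 h3
      exact Step.spend _ _ _
    · obtain ⟨h1, h2, h3⟩ := summary_update_reuse hv hfresh hfree
      rw [hs', hs] at h1 h2 h3
      obtain ⟨F, T, U⟩ := s
      obtain ⟨F', T', U'⟩ := s'
      dsimp only at h1 h2 h3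
      subst h1 h2 h3
      exact Step.reuse _ _ _

lemma exists_loose {f : (Σ i : Fin k, Fin (r i)) → Option (Fin m)}
    (h : 0 < (summary f).loose) : ∃ v, f v = none ∧ v.1 ∉ freshParts f := by
  obtain ⟨v, hv⟩ := card_pos.1 h
  exact ⟨v, (mem_filter.1 hv).2⟩

lemma exists_free {f : (Σ i : Fin k, Fin (r i)) → Option (Fin m)}
    (h : 0 < (summary f).free) : ∃ c, c ∈ freeColors f := card_pos.1 h

lemma exists_gameMove_of_step (hr : ∀ i, 0 < r i)
    {f : (Σ i : Fin k, Fin (r i)) → Option (Fin m)} (hf : IsProper f) {s : Summary k}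
    (h : Step r (summary f) s) : ∃ f', gameMove (K k r) f f' ∧ summary f' = s := by
  generalize hs : summary f = s₀ at h
  cases h with
  | reuse F T U =>
    obtain ⟨v, hv, hfresh⟩ := exists_loose (f := f) (by rw [hs]; exact Nat.succ_pos _)
    obtain ⟨c, hc, hlegal⟩ := exists_used_legalColor hf hfresh
    obtain ⟨h1, h2, h3⟩ := summary_update_reuse hv hfresh hc
    rw [hs] at h1 h2 h3
    exact ⟨_, ⟨v, c, hv, hlegal, rfl⟩, Summary.ext h1 (Nat.succ_injective h2) h3⟩
  | spend F T U =>
    obtain ⟨v, hv, hfresh⟩ := exists_loose (f := f) (by rw [hs]; exact Nat.succ_pos _)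
    obtain ⟨c, hc⟩ := exists_free (f := f) (by rw [hs]; exact Nat.succ_pos _)
    obtain ⟨h1, h2, h3⟩ := summary_update_spend hv hfresh hc
    rw [hs] at h1 h2 h3
    exact ⟨_, ⟨v, c, hv, legalColor_of_mem_freeColors hc v, rfl⟩,
      Summary.ext (Nat.succ_injective h1) (Nat.succ_injective h2) h3⟩
  | touch F T T' U i hi hT =>
    have hfresh : i ∈ freshParts f := by
      have : i ∈ (summary f).fresh := by rw [hs]; exact hi
      exact this
    have hv : f ⟨i, ⟨0, hr i⟩⟩ = none := (mem_filter.1 hfresh).2 _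
    obtain ⟨c, hc⟩ := exists_free (f := f) (by rw [hs]; exact Nat.succ_pos _)
    obtain ⟨h1, h2, h3⟩ := summary_update_touch hv hfresh hc
    rw [hs] at h1 h2 h3
    exact ⟨_, ⟨_, c, hv, legalColor_of_mem_freeColors hc _, rfl⟩,
      Summary.ext (Nat.succ_injective h1) (Nat.succ_injective (h2.trans hT.symm)) h3⟩

lemma not_isStuck {f : (Σ i : Fin k, Fin (r i)) → Option (Fin m)} (hf : IsProper f)
    (h : (summary f).free = 0 → (summary f).fresh = ∅) : ¬ isStuck (K k r) f := by
  rintro ⟨v, -, hc⟩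
  have hfree : freeColors f = ∅ :=
    eq_empty_of_forall_notMem fun c hmem => hc c (legalColor_of_mem_freeColors hmem v)
  have hfresh : freshParts f = ∅ := h (card_eq_zero.2 hfree)
  obtain ⟨c, -, hlegal⟩ := exists_used_legalColor hf (v := v) (by simp [hfresh])
  exact hc c hlegal

lemma isStuck_of_free_eq_zero (hr : ∀ i, 0 < r i)
    {f : (Σ i : Fin k, Fin (r i)) → Option (Fin m)} (hfree : (summary f).free = 0)
    (hfresh : (summary f).fresh.Nonempty) : isStuck (K k r) f := by
  obtain ⟨i, hi⟩ := hfresh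
  have hi' : i ∈ freshParts f := hi
  refine ⟨⟨i, ⟨0, hr i⟩⟩, (mem_filter.1 hi').2 _, fun c hc => ?_⟩
  have h0 : freeColors f = ∅ := card_eq_zero.1 hfree
  simpa [h0] using mem_freeColors_of_legalColor hc hi'

lemma isFull_iff {f : (Σ i : Fin k, Fin (r i)) → Option (Fin m)} :
    isFull f ↔ (summary f).size r = 0 := by
  rw [size_summary, card_eq_zero, filter_eq_empty_iff]
  simp [isFull, Option.isSome_iff_ne_none]

lemma aliceTurn_iff (hodd : Odd (∑ i, r i))
    (f : (Σ i : Fin k, Fin (r i)) → Option (Fin m)) :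
    aliceTurn f ↔ Odd ((summary f).size r) := by
  have h := card_filter_add_card_filter_not (s := univ) (fun v => f v = none)
  rw [size_summary, aliceTurn]
  have e : (univ.filter fun v => (f v).isSome = true) = univ.filter fun v => ¬ f v = none := by
    ext v
    simp [Option.isSome_iff_ne_none]
  have hcard : (univ : Finset (Σ i : Fin k, Fin (r i))).card = ∑ i, r i := by
    simp
  rw [hcard] at h
  rw [e]
  grind

lemma size_of_step {s s' : Summary k} (h : Step r s s') : s'.size r + 1 = s.size r := by
  cases h with
  | reuse F T U => simp only [Summary.size]; omega
  | spend F T U => simp only [Summary.size]; omega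
  | touch F T T' U i hi hT =>
    have := add_sum_erase U r hi
    simp only [Summary.size]
    omega

/-- Alice wins if she can keep moving between positions satisfying `A` (when it is her turn)
and `B` (when it is the turn of Bob). -/
lemma aliceWinsFrom_of_invariant (hr : ∀ i, 0 < r i) (hodd : Odd (∑ i, r i))
    {A B : Summary k → Prop}
    (hA : ∀ s, A s → 0 < s.size r → ∃ s', Step r s s' ∧ B s')
    (hB : ∀ s s', B s → Step r s s' → A s')
    (hAs : ∀ s, A s → s.free = 0 → s.fresh = ∅)
    (hBs : ∀ s, B s → s.free = 0 → s.fresh = ∅) (n : ℕ) :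
    ∀ f : (Σ i : Fin k, Fin (r i)) → Option (Fin m), IsProper f → (summary f).size r = n →
      (Odd n → A (summary f)) → (¬ Odd n → B (summary f)) → aliceWinsFrom (K k r) n f := by
  induction n with
  | zero => exact fun f _ hn _ _ => isFull_iff.2 hn
  | succ n ih =>
    intro f hf hn h1 h2
    refine Or.inr ?_
    by_cases ho : Odd (n + 1)
    · refine ⟨not_isStuck hf (hAs _ (h1 ho)), Or.inl ⟨(aliceTurn_iff hodd f).2 (hn ▸ ho), ?_⟩⟩
      obtain ⟨s', hs', hBs'⟩ := hA _ (h1 ho) (by omega)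
      obtain ⟨f', hmove, rfl⟩ := exists_gameMove_of_step hr hf hs'
      refine ⟨f', hmove, ih f' (hf.of_gameMove hmove) ?_ (fun h => ?_) (fun _ => hBs')⟩
      · have := size_of_step hs'
        omega
      · grind
    · refine ⟨not_isStuck hf (hBs _ (h2 ho)),
        Or.inr ⟨fun h => ho (hn ▸ (aliceTurn_iff hodd f).1 h), fun f' hmove => ?_⟩⟩
      have hs' := step_of_gameMove hmove
      refine ih f' (hf.of_gameMove hmove) ?_ (fun _ => hB _ _ (h2 ho) hs') (fun h => ?_)
      · have := size_of_step hs'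
        omega
      · grind

/-- Bob wins if he can answer every move of Alice so that `J` always holds at his turns. -/
lemma not_aliceWinsFrom_of_invariant (hr : ∀ i, 0 < r i) (hodd : Odd (∑ i, r i))
    {A J : Summary k → Prop}
    (hA : ∀ s s', A s → Step r s s' → J s')
    (hJ : ∀ s, J s → s.free = 0 ∨ ∃ s', Step r s s' ∧ A s')
    (hJs : ∀ s, J s → s.fresh.Nonempty) (n : ℕ) :
    ∀ f : (Σ i : Fin k, Fin (r i)) → Option (Fin m), IsProper f → (summary f).size r = n →
      (Odd n → A (summary f)) → (¬ Odd n → J (summary f)) → ¬ aliceWinsFrom (K k r) n f := by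
  have hpos : ∀ s : Summary k, s.fresh.Nonempty → 0 < s.size r := by
    rintro s ⟨i, hi⟩
    have := single_le_sum (f := r) (fun _ _ => Nat.zero_le _) hi
    have := hr i
    simp only [Summary.size]
    omega
  induction n with
  | zero =>
    intro f _ hn _ h2 _
    have := hpos _ (hJs _ (h2 (by simp)))
    omega
  | succ n ih =>
    intro f hf hn h1 h2 hwin
    rcases hwin with hfull | ⟨hstuck, ⟨hturn, f', hmove, hwin⟩ | ⟨hturn, hwin⟩⟩
    · have := isFull_iff.1 hfull
      omega
    · have ho : Odd (n + 1) := hn ▸ (aliceTurn_iff hodd f).1 hturn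
      have hs' := step_of_gameMove hmove
      refine ih f' (hf.of_gameMove hmove) ?_ (fun h => ?_)
        (fun _ => hA _ _ (h1 ho) hs') hwin
      · have := size_of_step hs'
        omega
      · grind
    · have ho : ¬ Odd (n + 1) := fun h => hturn ((aliceTurn_iff hodd f).2 (hn ▸ h))
      have hJf := h2 ho
      rcases hJ _ hJf with h0 | ⟨s', hs', hAs'⟩
      · exact hstuck (isStuck_of_free_eq_zero hr h0 (hJs _ hJf))
      · obtain ⟨f', hmove, rfl⟩ := exists_gameMove_of_step hr hf hs'
        refine ih f' (hf.of_gameMove hmove) ?_ (fun _ => hAs') (fun h => ?_) (hwin f' hmove)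
        · have := size_of_step hs'
          omega
        · grind

lemma isProper_none : IsProper (fun _ : Σ i : Fin k, Fin (r i) => (none : Option (Fin m))) := by
  intro v w c h
  simp at h

lemma summary_none :
    summary (fun _ : Σ i : Fin k, Fin (r i) => (none : Option (Fin m))) = ⟨m, 0, univ⟩ := by
  simp [summary, freshParts, freeColors]

lemma aliceWins_of_invariant (hr : ∀ i, 0 < r i) (hodd : Odd (∑ i, r i))
    {A B : Summary k → Prop}
    (hA : ∀ s, A s → 0 < s.size r → ∃ s', Step r s s' ∧ B s')
    (hB : ∀ s s', B s → Step r s s' → A s')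
    (hAs : ∀ s, A s → s.free = 0 → s.fresh = ∅)
    (hBs : ∀ s, B s → s.free = 0 → s.fresh = ∅) (h : A ⟨m, 0, univ⟩) :
    aliceWins (K k r) m := by
  have hcard : Fintype.card (Σ i : Fin k, Fin (r i)) = ∑ i, r i := by simp
  refine aliceWinsFrom_of_invariant hr hodd hA hB hAs hBs _ _ isProper_none ?_
    (fun _ => ?_) (fun h' => ?_)
  · rw [summary_none, hcard]
    simp [Summary.size]
  · rwa [summary_none]
  · rw [hcard] at h'
    exact absurd hodd h'

lemma not_aliceWins_of_invariant (hr : ∀ i, 0 < r i) (hodd : Odd (∑ i, r i))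
    {A J : Summary k → Prop}
    (hA : ∀ s s', A s → Step r s s' → J s')
    (hJ : ∀ s, J s → s.free = 0 ∨ ∃ s', Step r s s' ∧ A s')
    (hJs : ∀ s, J s → s.fresh.Nonempty) (h : A ⟨m, 0, univ⟩) :
    ¬ aliceWins (K k r) m := by
  have hcard : Fintype.card (Σ i : Fin k, Fin (r i)) = ∑ i, r i := by simp
  refine not_aliceWinsFrom_of_invariant hr hodd hA hJ hJs _ _ isProper_none ?_
    (fun _ => ?_) (fun h' => ?_)
  · rw [summary_none, hcard]
    simp [Summary.size]
  · rwa [summary_none]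
  · rw [hcard] at h'
    exact absurd hodd h'

end Concrete

section Strategies

variable {k m : ℕ} {r : Fin k → ℕ}

/-- Alice wins with at least `2 * k - 1` colors by always coloring in a fresh part. -/
lemma aliceWins_of_two_mul_le (hr : ∀ i, 0 < r i) (hodd : Odd (∑ i, r i))
    (hm : 2 * k ≤ m + 1) : aliceWins (K k r) m := by
  refine aliceWins_of_invariant hr hodd (A := fun s => 2 * s.fresh.card ≤ s.free + 1)
    (B := fun s => 2 * s.fresh.card ≤ s.free) ?_ ?_ ?_ ?_ (by simpa using hm)
  · rintro ⟨F, T, U⟩ h hsize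
    dsimp only at h
    rcases U.eq_empty_or_nonempty with rfl | ⟨i, hi⟩
    · simp only [Summary.size, sum_empty] at hsize
      obtain ⟨T, rfl⟩ : ∃ T', T = T' + 1 := ⟨T - 1, by omega⟩
      exact ⟨_, Step.reuse _ _ _, by simp⟩
    · have hc := card_erase_add_one hi
      have := hr i
      obtain ⟨F, rfl⟩ : ∃ F', F = F' + 1 := ⟨F - 1, by omega⟩
      refine ⟨_, Step.touch F T (T + r i - 1) U i hi (by omega), ?_⟩
      dsimp only
      omega
  · intro s s' h hs
    cases hs with
    | reuse F T U => dsimp only at *; omega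
    | spend F T U => dsimp only at *; omega
    | touch F T T' U i hi hT =>
      have hc := card_erase_add_one hi
      dsimp only at *
      omega
  · intro s h h0
    rw [← card_eq_zero]
    omega
  · intro s h h0
    rw [← card_eq_zero]
    omega

lemma exists_odd_of_odd_sum {U : Finset (Fin k)} (h : Odd (∑ i ∈ U, r i)) :
    ∃ i ∈ U, Odd (r i) := by
  by_contra! hne
  exact Nat.not_odd_iff_even.2 (even_sum r fun i hi => Nat.not_odd_iff_even.1 (hne i hi)) h

lemma fresh_eq_empty_of_potential_eq_zero (hr : ∀ i, 0 < r i) {s : Summary k}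
    (h : s.potential r = 0) : s.fresh = ∅ := by
  refine eq_empty_of_forall_notMem fun i hi => ?_
  have := single_le_sum (f := fun i => (r i + 1) / 2) (fun _ _ => Nat.zero_le _) hi
  have := hr i
  simp only [Summary.potential] at h
  omega

/-- With an odd number of uncolored vertices, Alice can bring the potential down to the number
of unused colors, by reusing a color or by coloring in a fresh part of odd size. -/
lemma exists_step_potential_le (hr : ∀ i, 0 < r i) {s : Summary k} (hsize : Odd (s.size r))
    (h : s.potential r ≤ s.free + s.loose % 2) :
    ∃ s', Step r s s' ∧ Even (s'.size r) ∧ s'.potential r ≤ s'.free := by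
  suffices ∃ s', Step r s s' ∧ s'.potential r ≤ s'.free by
    obtain ⟨s', hs, hp⟩ := this
    refine ⟨s', hs, ?_, hp⟩
    have := size_of_step hs
    grind
  obtain ⟨F, T, U⟩ := s
  simp only [Summary.size, Summary.potential] at *
  rcases Nat.even_or_odd' T with ⟨t, rfl | rfl⟩
  · obtain ⟨i, hi, ho⟩ := exists_odd_of_odd_sum (U := U) (r := r) (by grind)
    have h1 := add_sum_erase U (fun i => (r i + 1) / 2) hi
    have := hr i
    obtain ⟨a, ha⟩ := ho
    obtain ⟨F, rfl⟩ : ∃ F', F = F' + 1 := ⟨F - 1, by omega⟩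
    refine ⟨_, Step.touch F _ (2 * t + r i - 1) U i hi (by omega), ?_⟩
    dsimp only
    omega
  · refine ⟨_, Step.reuse _ _ _, ?_⟩
    dsimp only
    omega

/-- Alice wins with at least `∑ ⌈rᵢ / 2⌉` colors when the number of vertices is odd. -/
lemma aliceWins_of_sum_le (hr : ∀ i, 0 < r i) (hodd : Odd (∑ i, r i))
    (hm : ∑ i, (r i + 1) / 2 ≤ m) : aliceWins (K k r) m := by
  refine aliceWins_of_invariant hr hodd
    (A := fun s => (s.free = 0 → s.fresh = ∅) ∧ Odd (s.size r) ∧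
      s.potential r ≤ s.free + s.loose % 2)
    (B := fun s => Even (s.size r) ∧ s.potential r ≤ s.free) ?_ ?_ (fun s h => h.1) ?_ ?_
  · exact fun s hA _ => exists_step_potential_le hr hA.2.1 hA.2.2
  · rintro s s' ⟨h1, h2⟩ hs
    have hsize := size_of_step hs
    refine ⟨fun h0 => ?_, by grind, ?_⟩
    · by_contra hne
      obtain ⟨j, hj⟩ := nonempty_iff_ne_empty.2 hne
      have hrj := hr j
      cases hs with
      | reuse F T U =>
        have := add_sum_erase U (fun i => (r i + 1) / 2) hj
        simp only [Summary.potential] at *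
        omega
      | spend F T U =>
        have := add_sum_erase U (fun i => (r i + 1) / 2) hj
        simp only [Summary.potential] at *
        omega
      | touch F T T' U i hi hT =>
        have := add_sum_erase U (fun i => (r i + 1) / 2) hi
        have := add_sum_erase (U.erase i) (fun i => (r i + 1) / 2) hj
        have := hr i
        simp only [Summary.potential] at *
        omega
    · cases hs with
      | reuse F T U => simp only [Summary.potential] at *; omega
      | spend F T U => simp only [Summary.potential] at *; omega
      | touch F T T' U i hi hT =>
        have := add_sum_erase U (fun i => (r i + 1) / 2) hi
        simp only [Summary.potential] at *
        omega
  · rintro s ⟨-, h2⟩ h0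
    exact fresh_eq_empty_of_potential_eq_zero hr (by omega)
  · refine ⟨fun h0 => ?_, by simpa [Summary.size] using hodd, by simpa [Summary.potential] using hm⟩
    refine fresh_eq_empty_of_potential_eq_zero (s := ⟨m, 0, univ⟩) hr ?_
    simp only [Summary.potential] at *
    omega

/-- A condition under which Bob, whose turn it is, wins if there are no parts of
size `1` or `3`. -/
def BobWins (r : Fin k → ℕ) (s : Summary k) : Prop :=
  s.free < s.fresh.card ∨
    (s.free < s.potential r ∧ s.free + 1 ≤ 2 * s.fresh.card ∧
      (2 * s.free + 6 ≤ 4 * s.fresh.card + s.loose ∨ s.loose % 2 = 1))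

lemma BobWins.fresh_nonempty {s : Summary k} (h : BobWins r s) : s.fresh.Nonempty := by
  rw [← card_pos]
  rcases h with h | h <;> omega

lemma bobWins_spend (h2 : ∀ i, 2 ≤ r i) (h3 : ∀ i, r i ≠ 3) {F T : ℕ} {U : Finset (Fin k)}
    (h : BobWins r ⟨F + 1, T + 1, U⟩) {s : Summary k} (hs : Step r ⟨F, T, U⟩ s) :
    BobWins r s := by
  cases hs with
  | reuse F T U => simp only [BobWins, Summary.potential] at *; omega
  | spend F T U => simp only [BobWins, Summary.potential] at *; omega
  | touch F T T' U i hi hT =>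
    have := add_sum_erase U (fun i => (r i + 1) / 2) hi
    have := card_erase_add_one hi
    have := h2 i
    have := h3 i
    simp only [BobWins, Summary.potential] at *
    omega

lemma bobWins_touch (h2 : ∀ i, 2 ≤ r i) {F T : ℕ} {U : Finset (Fin k)} {i : Fin k}
    (hi : i ∈ U) (hT : T + 1 = r i)
    (h : F + 1 < U.card ∨ (4 ≤ r i ∧ BobWins r ⟨F + 1, 0, U⟩))
    {s : Summary k} (hs : Step r ⟨F, T, U.erase i⟩ s) : BobWins r s := by
  have := add_sum_erase U (fun i => (r i + 1) / 2) hi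
  have := card_erase_add_one hi
  generalize hV : U.erase i = V at *
  cases hs with
  | reuse F T => simp only [BobWins, Summary.potential] at *; omega
  | spend F T => simp only [BobWins, Summary.potential] at *; omega
  | touch F T T' V j hj hT =>
    have := add_sum_erase V (fun i => (r i + 1) / 2) hj
    have := card_erase_add_one hj
    have := h2 j
    simp only [BobWins, Summary.potential] at *
    omega

lemma BobWins.exists_step (h2 : ∀ i, 2 ≤ r i) (h3 : ∀ i, r i ≠ 3) {s : Summary k}
    (h : BobWins r s) :
    s.free = 0 ∨ ∃ s', Step r s s' ∧ ∀ s'', Step r s' s'' → BobWins r s'' := by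
  have hne := h.fresh_nonempty
  obtain ⟨F, T, U⟩ := s
  rcases F with _ | F
  · exact Or.inl rfl
  refine Or.inr ?_
  rcases T with _ | T
  · suffices ∃ i ∈ U, F + 1 < U.card ∨ (4 ≤ r i ∧ BobWins r ⟨F + 1, 0, U⟩) by
      obtain ⟨i, hi, hor⟩ := this
      have := h2 i
      refine ⟨_, Step.touch F 0 (r i - 1) U i hi (by omega),
        fun s'' => bobWins_touch h2 hi (by omega) hor⟩
    by_cases hbig : ∃ i ∈ U, 4 ≤ r i
    · obtain ⟨i, hi, h4⟩ := hbig
      exact ⟨i, hi, Or.inr ⟨h4, h⟩⟩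
    · push Not at hbig
      obtain ⟨i, hi⟩ := hne
      refine ⟨i, hi, Or.inl ?_⟩
      have hsum : ∑ i ∈ U, (r i + 1) / 2 = U.card := by
        rw [card_eq_sum_ones]
        refine sum_congr rfl fun j hj => ?_
        have := hbig j hj
        have := h2 j
        have := h3 j
        omega
      simp only [BobWins, Summary.potential] at h
      omega
  · exact ⟨_, Step.spend F T U, fun s'' => bobWins_spend h2 h3 h⟩

/-- Bob wins with fewer than `min (2 * k - 1) (∑ ⌈rᵢ / 2⌉)` colors if no part has size `1` or `3`. -/
lemma not_aliceWins (h2 : ∀ i, 2 ≤ r i) (h3 : ∀ i, r i ≠ 3) (hodd : Odd (∑ i, r i))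
    (hm : m + 1 < 2 * k) (hm' : m < ∑ i, (r i + 1) / 2) : ¬ aliceWins (K k r) m := by
  refine not_aliceWins_of_invariant (fun i => by have := h2 i; omega) hodd
    (A := fun s => ∀ s', Step r s s' → BobWins r s') (J := BobWins r)
    (fun s s' h hs => h s' hs) (fun s h => h.exists_step h2 h3)
    (fun s h => h.fresh_nonempty) (fun s' hs => ?_)
  generalize hU : (univ : Finset (Fin k)) = U at *
  have hk : U.card = k := by simp [← hU]
  cases hs with
  | touch F T T' U i hi hT =>
    have := add_sum_erase U (fun i => (r i + 1) / 2) hi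
    have := card_erase_add_one hi
    have := h2 i
    have := h3 i
    simp only [BobWins, Summary.potential] at *
    omega

end Strategies

end MultipartiteGame

theorem game_chromatic_eq_of_min_two_no_three_odd (k : ℕ) (hk : 3 ≤ k) (r : Fin k → ℕ)
    (hanti : Antitone r) (hlast : r ⟨k - 1, by omega⟩ = 2) (hne3 : ∀ j, r j ≠ 3)
    (hodd : Odd (∑ i, r i)) :
    gameChromaticNumber (K k r) = min (2 * k - 1) (∑ i, (r i + 1) / 2) := by
  have h2 : ∀ i, 2 ≤ r i := fun i => by
    rw [← hlast]
    exact hanti (Fin.le_def.2 (Nat.le_sub_one_of_lt i.2))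
  have hr : ∀ i, 0 < r i := fun i => by have := h2 i; omega
  have hwin : aliceWins (K k r) (min (2 * k - 1) (∑ i, (r i + 1) / 2)) := by
    rcases le_total (2 * k - 1) (∑ i, (r i + 1) / 2) with h | h
    · exact MultipartiteGame.aliceWins_of_two_mul_le hr hodd (by omega)
    · exact MultipartiteGame.aliceWins_of_sum_le hr hodd (by omega)
  refine le_antisymm (Nat.sInf_le hwin) (le_csInf ⟨_, hwin⟩ fun m hm => ?_)
  by_contra! hlt
  exact MultipartiteGame.not_aliceWins h2 hne3 hodd (by omega) (by omega) hm
end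

section
/- Let K_{r_1,…,r_k} be a complete multipartite graph with k ≥ 3 parts whose smallest part has size r_k = 3 (so every part has at least 3 vertices and some part has exactly 3). Then the game chromatic number satisfies χ_g(K_{r_1,…,r_k}) = 2k − 2. -/
namespace MultipartiteGame

set_option linter.unusedSectionVars false

open Finset

section

variable {ι : Type} [Fintype ι] [DecidableEq ι] {β : ι → Type} [∀ i, Fintype (β i)]
  [∀ i, DecidableEq (β i)] {C : Type} [Fintype C] [DecidableEq C]

/-- The colors that have not been used yet. -/
def free (f : (Σ i, β i) → Option C) : Finset C := univ.filter fun c => ∀ v, f v ≠ some c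

/-- The parts without colored vertices. -/
def untouched (f : (Σ i, β i) → Option C) : Finset ι :=
  univ.filter fun i => ∀ j, f ⟨i, j⟩ = none

/-- The uncolored vertices. -/
def uncolored (f : (Σ i, β i) → Option C) : Finset (Σ i, β i) :=
  univ.filter fun v => f v = none

/-- The uncolored vertices in parts that already contain a colored vertex. -/
def pool (f : (Σ i, β i) → Option C) : Finset (Σ i, β i) :=
  uncolored f \ (untouched f).sigma fun _ => univ

/-- Vertices of the same color lie in the same part. -/
def Proper (f : (Σ i, β i) → Option C) : Prop :=
  ∀ v w c, f v = some c → f w = some c → v.1 = w.1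

variable {f f' : (Σ i, β i) → Option C} {v : Σ i, β i} {c : C}

lemma mem_free : c ∈ free f ↔ ∀ v, f v ≠ some c := by simp [free]

lemma mem_untouched {i : ι} : i ∈ untouched f ↔ ∀ j, f ⟨i, j⟩ = none := by simp [untouched]

lemma mem_uncolored : v ∈ uncolored f ↔ f v = none := by simp [uncolored]

lemma mem_pool : v ∈ pool f ↔ f v = none ∧ v.1 ∉ untouched f := by simp [pool, mem_uncolored]

lemma legalColor_iff :
    legalColor (SimpleGraph.completeMultipartiteGraph β) f v c ↔
      ∀ w, f w = some c → w.1 = v.1 := by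
  simp only [legalColor, SimpleGraph.completeMultipartiteGraph, SimpleGraph.comap_adj,
    SimpleGraph.top_adj]
  grind

lemma legalColor_of_mem_free (hc : c ∈ free f) :
    legalColor (SimpleGraph.completeMultipartiteGraph β) f v c :=
  fun w _ => mem_free.1 hc w

lemma exists_legalColor_of_touched (hf : Proper f) (hv : v.1 ∉ untouched f) :
    ∃ c ∉ free f, legalColor (SimpleGraph.completeMultipartiteGraph β) f v c := by
  rw [mem_untouched] at hv
  push Not at hv
  obtain ⟨j, hj⟩ := hv
  obtain ⟨c, hc⟩ := Option.ne_none_iff_exists'.1 hj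
  refine ⟨c, fun h => mem_free.1 h _ hc, legalColor_iff.2 fun w hw => ?_⟩
  exact hf w ⟨v.1, j⟩ c hw hc

lemma card_pool_add :
    #(pool f) + ∑ i ∈ untouched f, Fintype.card (β i) = #(uncolored f) := by
  have h : (untouched f).sigma (fun i => (univ : Finset (β i))) ⊆ uncolored f := by
    rintro ⟨i, j⟩ h
    simp only [mem_sigma, mem_univ, and_true] at h
    exact mem_uncolored.2 (mem_untouched.1 h j)
  have h' := card_sdiff_add_card_eq_card h
  rwa [card_sigma] at h'

lemma isFull_iff_s13 : isFull f ↔ uncolored f = ∅ := by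
  simp [isFull, Finset.eq_empty_iff_forall_notMem, mem_uncolored, Option.isSome_iff_ne_none]

lemma card_colored_add :
    #(univ.filter fun v => (f v).isSome = true) + #(uncolored f) = Fintype.card (Σ i, β i) := by
  have : uncolored f = univ.filter fun v => ¬ (f v).isSome = true := by
    ext v; simp [mem_uncolored]
  rw [this, card_filter_add_card_filter_not, card_univ]

lemma isStuck_of_free_eq_empty (hF : #(free f) = 0) (hU : 0 < #(untouched f))
    (hβ : ∀ i, 3 ≤ Fintype.card (β i)) :
    isStuck (SimpleGraph.completeMultipartiteGraph β) f := by
  obtain ⟨i, hi⟩ := card_pos.1 hU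
  obtain ⟨j⟩ := Fintype.card_pos_iff.1 (by have := hβ i; omega : 0 < Fintype.card (β i))
  refine ⟨⟨i, j⟩, mem_untouched.1 hi j, fun c hc => ?_⟩
  have hc' : c ∉ free f := by simp [card_eq_zero.1 hF]
  rw [mem_free] at hc'
  push Not at hc'
  obtain ⟨⟨i', j'⟩, hw⟩ := hc'
  obtain rfl : i' = i := legalColor_iff.1 hc _ hw
  simp [mem_untouched.1 hi j'] at hw

lemma not_isStuck_s13 (hf : Proper f) (h : #(untouched f) = 0 ∨ 0 < #(free f)) :
    ¬ isStuck (SimpleGraph.completeMultipartiteGraph β) f := by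
  rintro ⟨v, -, hc⟩
  by_cases hv : v.1 ∈ untouched f
  · have : 0 < #(free f) := h.resolve_left (card_ne_zero_of_mem hv)
    obtain ⟨c, hc'⟩ := card_pos.1 this
    exact hc c (legalColor_of_mem_free hc')
  · obtain ⟨c, -, hc'⟩ := exists_legalColor_of_touched hf hv
    exact hc c hc'

lemma proper_of_gameMove (hf : Proper f)
    (h : gameMove (SimpleGraph.completeMultipartiteGraph β) f f') : Proper f' := by
  obtain ⟨v, c, hv, hc, rfl⟩ := h
  rw [legalColor_iff] at hc
  intro x y d hx hy
  rw [Function.update_apply] at hx hy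
  split_ifs at hx hy with h1 h2 h2
  · rw [h1, h2]
  · rw [h1]
    exact (hc y (by rw [hy, hx])).symm
  · rw [h2]
    exact hc x (by rw [hx, hy])
  · exact hf x y d hx hy

lemma uncolored_update : uncolored (Function.update f v (some c)) = (uncolored f).erase v := by
  ext w
  by_cases h : w = v <;> simp [mem_uncolored, h]

lemma card_uncolored_of_gameMove
    (h : gameMove (SimpleGraph.completeMultipartiteGraph β) f f') :
    #(uncolored f') + 1 = #(uncolored f) := by
  obtain ⟨v, c, hv, hc, rfl⟩ := h
  rw [uncolored_update, card_erase_add_one (mem_uncolored.2 hv)]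

lemma aliceTurn_of_gameMove
    (h : gameMove (SimpleGraph.completeMultipartiteGraph β) f f') :
    aliceTurn f' ↔ ¬ aliceTurn f := by
  have h1 := card_uncolored_of_gameMove h
  have h2 := card_colored_add (f := f)
  have h3 := card_colored_add (f := f')
  have h4 : #(univ.filter fun v => (f' v).isSome = true)
      = #(univ.filter fun v => (f v).isSome = true) + 1 := by omega
  unfold aliceTurn
  rw [h4, Nat.even_add_one]

lemma free_update (hv : f v = none) :
    free (Function.update f v (some c)) = (free f).erase c := by
  ext d
  simp only [mem_erase, mem_free]
  constructor
  · refine fun hd => ⟨fun h => hd v (by simp [h]), fun w hw => ?_⟩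
    have hne : w ≠ v := by rintro rfl; simp [hv] at hw
    exact hd w (by simpa [hne] using hw)
  · rintro ⟨hd, h⟩ w hw
    rw [Function.update_apply] at hw
    split_ifs at hw
    · exact hd (Option.some.inj hw).symm
    · exact h w hw

lemma untouched_update :
    untouched (Function.update f v (some c)) = (untouched f).erase v.1 := by
  ext i
  simp only [mem_erase, mem_untouched]
  constructor
  · intro h
    have hi : i ≠ v.1 := by
      rintro rfl
      simpa using h v.2
    refine ⟨hi, fun j => ?_⟩
    have hne : (⟨i, j⟩ : Σ i, β i) ≠ v := by rintro rfl; exact hi rfl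
    simpa [hne] using h j
  · rintro ⟨hi, h⟩ j
    have hne : (⟨i, j⟩ : Σ i, β i) ≠ v := by rintro rfl; exact hi rfl
    simpa [hne] using h j

lemma gameMove_update (hv : f v = none)
    (hc : legalColor (SimpleGraph.completeMultipartiteGraph β) f v c) :
    gameMove (SimpleGraph.completeMultipartiteGraph β) f (Function.update f v (some c)) :=
  ⟨v, c, hv, hc, rfl⟩

lemma card_pool_update_of_touched (hv : f v = none) (hi : v.1 ∉ untouched f) :
    #(pool (Function.update f v (some c))) + 1 = #(pool f) := by
  have h1 := card_pool_add (f := f)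
  have h2 := card_pool_add (f := Function.update f v (some c))
  have h3 := card_erase_add_one (mem_uncolored.2 hv)
  rw [untouched_update, uncolored_update, erase_eq_of_notMem hi] at h2
  omega

lemma card_pool_update_of_untouched (hi : v.1 ∈ untouched f) :
    #(pool (Function.update f v (some c))) + 1 = #(pool f) + Fintype.card (β v.1) := by
  have hv : f v = none := mem_untouched.1 hi v.2
  have h1 := card_pool_add (f := f)
  have h2 := card_pool_add (f := Function.update f v (some c))
  have h3 := card_erase_add_one (mem_uncolored.2 hv)
  rw [untouched_update, uncolored_update] at h2
  have h4 := sum_erase_add (untouched f) (fun i => Fintype.card (β i)) hi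
  omega

/-- A legal move repeats a color in a touched part, uses a new color in a touched part, or
touches a new part. -/
lemma gameMove_cases (h : gameMove (SimpleGraph.completeMultipartiteGraph β) f f') :
    (#(free f') = #(free f) ∧ #(untouched f') = #(untouched f) ∧ #(pool f') + 1 = #(pool f)) ∨
    (#(free f') + 1 = #(free f) ∧ #(untouched f') = #(untouched f) ∧
      #(pool f') + 1 = #(pool f)) ∨
    ∃ i, #(free f') + 1 = #(free f) ∧ #(untouched f') + 1 = #(untouched f) ∧
      #(pool f') + 1 = #(pool f) + Fintype.card (β i) := by
  obtain ⟨v, c, hv, hc, rfl⟩ := h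
  by_cases hi : v.1 ∈ untouched f
  · have hc' : c ∈ free f := by
      rw [mem_free]
      rintro ⟨i, j⟩ hw
      obtain rfl : i = v.1 := legalColor_iff.1 hc _ hw
      simp [mem_untouched.1 hi j] at hw
    refine .inr (.inr ⟨v.1, ?_, ?_, card_pool_update_of_untouched hi⟩)
    · rw [free_update hv, card_erase_add_one hc']
    · rw [untouched_update, card_erase_add_one hi]
  · have hT := card_pool_update_of_touched (c := c) hv hi
    have hU : #(untouched (Function.update f v (some c))) = #(untouched f) := by
      rw [untouched_update, erase_eq_of_notMem hi]
    by_cases hc' : c ∈ free f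
    · exact .inr (.inl ⟨by rw [free_update hv, card_erase_add_one hc'], hU, hT⟩)
    · exact .inl ⟨by rw [free_update hv, erase_eq_of_notMem hc'], hU, hT⟩

lemma exists_repeat (hf : Proper f) (hT : 0 < #(pool f)) :
    ∃ f', gameMove (SimpleGraph.completeMultipartiteGraph β) f f' ∧ #(free f') = #(free f) ∧
      #(untouched f') = #(untouched f) ∧ #(pool f') + 1 = #(pool f) := by
  obtain ⟨v, hv⟩ := card_pos.1 hT
  obtain ⟨hv, hi⟩ := mem_pool.1 hv
  obtain ⟨c, hc', hc⟩ := exists_legalColor_of_touched hf hi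
  refine ⟨_, gameMove_update hv hc, ?_, ?_, card_pool_update_of_touched hv hi⟩
  · rw [free_update hv, erase_eq_of_notMem hc']
  · rw [untouched_update, erase_eq_of_notMem hi]

lemma exists_burn (hT : 0 < #(pool f)) (hF : 0 < #(free f)) :
    ∃ f', gameMove (SimpleGraph.completeMultipartiteGraph β) f f' ∧ #(free f') + 1 = #(free f) ∧
      #(untouched f') = #(untouched f) ∧ #(pool f') + 1 = #(pool f) := by
  obtain ⟨v, hv⟩ := card_pos.1 hT
  obtain ⟨hv, hi⟩ := mem_pool.1 hv
  obtain ⟨c, hc⟩ := card_pos.1 hF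
  refine ⟨_, gameMove_update hv (legalColor_of_mem_free hc), ?_, ?_,
    card_pool_update_of_touched hv hi⟩
  · rw [free_update hv, card_erase_add_one hc]
  · rw [untouched_update, erase_eq_of_notMem hi]

lemma exists_touch {i : ι} (hi : i ∈ untouched f) (hβ : 0 < Fintype.card (β i))
    (hF : 0 < #(free f)) :
    ∃ f', gameMove (SimpleGraph.completeMultipartiteGraph β) f f' ∧ #(free f') + 1 = #(free f) ∧
      #(untouched f') + 1 = #(untouched f) ∧
      #(pool f') + 1 = #(pool f) + Fintype.card (β i) := by
  obtain ⟨j⟩ := Fintype.card_pos_iff.1 hβ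
  obtain ⟨c, hc⟩ := card_pos.1 hF
  have hv : f ⟨i, j⟩ = none := mem_untouched.1 hi j
  refine ⟨_, gameMove_update hv (legalColor_of_mem_free hc), ?_, ?_,
    card_pool_update_of_untouched (v := ⟨i, j⟩) hi⟩
  · rw [free_update hv, card_erase_add_one hc]
  · rw [untouched_update, card_erase_add_one hi]

variable (f) in
/-- Alice wins from the position `f`. -/
def Wins : Prop :=
  aliceWinsFrom (SimpleGraph.completeMultipartiteGraph β) #(uncolored f) f

lemma wins_of_aliceTurn (ht : aliceTurn f)
    (hs : ¬ isStuck (SimpleGraph.completeMultipartiteGraph β) f)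
    (h : gameMove (SimpleGraph.completeMultipartiteGraph β) f f') (hw : Wins f') : Wins f := by
  rw [Wins, ← card_uncolored_of_gameMove h]
  exact .inr ⟨hs, .inl ⟨ht, f', h, hw⟩⟩

lemma wins_of_uncolored_eq_empty (h : uncolored f = ∅) : Wins f := by
  rw [Wins, h]
  exact isFull_iff_s13.2 h

lemma wins_of_not_aliceTurn (ht : ¬ aliceTurn f)
    (hs : ¬ isStuck (SimpleGraph.completeMultipartiteGraph β) f)
    (hw : ∀ f', gameMove (SimpleGraph.completeMultipartiteGraph β) f f' → Wins f') : Wins f := by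
  rcases hn : #(uncolored f) with _ | n
  · exact wins_of_uncolored_eq_empty (card_eq_zero.1 hn)
  rw [Wins, hn]
  refine .inr ⟨hs, .inr ⟨ht, fun f' h => ?_⟩⟩
  have h1 := card_uncolored_of_gameMove h
  obtain rfl : n = #(uncolored f') := by omega
  exact hw f' h

lemma not_isFull_of_isStuck (h : isStuck (SimpleGraph.completeMultipartiteGraph β) f) :
    ¬ isFull f := by
  obtain ⟨v, hv, -⟩ := h
  intro hfull
  simpa [hv] using hfull v

lemma not_wins_of_isStuck (h : isStuck (SimpleGraph.completeMultipartiteGraph β) f) :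
    ¬ Wins f := by
  have h' := not_isFull_of_isStuck h
  unfold Wins
  rcases #(uncolored f) with _ | n
  · exact h'
  · rintro (hw | hw)
    · exact h' hw
    · exact hw.1 h

lemma not_wins_of_not_aliceTurn (ht : ¬ aliceTurn f)
    (h : gameMove (SimpleGraph.completeMultipartiteGraph β) f f') (hw : ¬ Wins f') :
    ¬ Wins f := by
  rw [Wins, ← card_uncolored_of_gameMove h]
  rintro (hfull | ⟨-, h' | h'⟩)
  · have := card_uncolored_of_gameMove h
    rw [isFull_iff_s13.1 hfull] at this
    simp at this
  · exact ht h'.1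
  · exact hw (h'.2 f' h)

lemma not_wins_of_aliceTurn (ht : aliceTurn f) (hU : 0 < #(uncolored f))
    (hw : ∀ f', gameMove (SimpleGraph.completeMultipartiteGraph β) f f' → ¬ Wins f') :
    ¬ Wins f := by
  obtain ⟨n, hn⟩ : ∃ n, #(uncolored f) = n + 1 := ⟨_, (Nat.succ_pred_eq_of_pos hU).symm⟩
  rw [Wins, hn]
  rintro (hfull | ⟨-, ⟨-, f', h, h'⟩ | h'⟩)
  · rw [isFull_iff_s13.1 hfull] at hU
    simp at hU
  · have h1 := card_uncolored_of_gameMove h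
    obtain rfl : n = #(uncolored f') := by omega
    exact hw f' h h'
  · exact h'.1 ht

/-- With enough free colors, Alice wins by always touching a new part. -/
lemma wins_of_card_free (hβ : ∀ i, 3 ≤ Fintype.card (β i)) :
    ∀ (n : ℕ) (f : (Σ i, β i) → Option C), #(uncolored f) = n → Proper f →
      (aliceTurn f → 2 * #(untouched f) ≤ #(free f) + 1) →
      (¬ aliceTurn f → 2 * #(untouched f) ≤ #(free f)) → Wins f := by
  intro n
  induction n with
  | zero => exact fun f hn _ _ _ => wins_of_uncolored_eq_empty (card_eq_zero.1 hn)
  | succ n ih =>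
    intro f hn hf hA hB
    by_cases ht : aliceTurn f
    · have hA := hA ht
      have hs := not_isStuck_s13 hf (by omega)
      obtain ⟨f', h, hf'⟩ : ∃ f', gameMove (SimpleGraph.completeMultipartiteGraph β) f f' ∧
          2 * #(untouched f') ≤ #(free f') := by
        rcases Nat.eq_zero_or_pos #(untouched f) with hU | hU
        · obtain ⟨v, hv⟩ := card_pos.1 (by omega : 0 < #(uncolored f))
          obtain ⟨c, -, hc⟩ := exists_legalColor_of_touched (v := v) hf
            (by simp [card_eq_zero.1 hU])
          have h := gameMove_update (mem_uncolored.1 hv) hc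
          refine ⟨_, h, ?_⟩
          rcases gameMove_cases h with h | h | ⟨i, h⟩ <;> omega
        · obtain ⟨i, hi⟩ := card_pos.1 hU
          obtain ⟨f', h, h'⟩ := exists_touch hi (by have := hβ i; omega) (by omega)
          exact ⟨f', h, by omega⟩
      have ht' : ¬ aliceTurn f' := by rw [aliceTurn_of_gameMove h]; exact not_not.2 ht
      refine wins_of_aliceTurn ht hs h (ih f' ?_ (proper_of_gameMove hf h)
        (fun h' => absurd h' ht') fun _ => hf')
      have := card_uncolored_of_gameMove h
      omega
    · have hB := hB ht
      refine wins_of_not_aliceTurn ht (not_isStuck_s13 hf (by omega)) fun f' h => ?_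
      have ht' : aliceTurn f' := (aliceTurn_of_gameMove h).2 ht
      refine ih f' ?_ (proper_of_gameMove hf h) (fun _ => ?_) (fun h' => absurd ht' h')
      · have := card_uncolored_of_gameMove h
        omega
      · rcases gameMove_cases h with h | h | ⟨i, h⟩ <;> omega

/-- With few free colors, Bob wins by using new colors in touched parts whenever he can. -/
lemma not_wins_of_card_free (hβ : ∀ i, 3 ≤ Fintype.card (β i)) :
    ∀ (n : ℕ) (f : (Σ i, β i) → Option C), #(uncolored f) = n →
      (aliceTurn f → #(free f) + 3 ≤ 2 * #(untouched f) ∨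
        #(free f) + 2 ≤ 2 * #(untouched f) ∧ 2 ≤ #(pool f)) →
      (¬ aliceTurn f → #(free f) + 3 ≤ 2 * #(untouched f) ∨
        #(free f) + 2 ≤ 2 * #(untouched f) ∧ 1 ≤ #(pool f) ∨
        #(free f) + 1 ≤ 2 * #(untouched f) ∧ 3 ≤ #(pool f)) → ¬ Wins f := by
  intro n
  induction n with
  | zero =>
    intro f hn hA hB
    have hU : 0 < #(untouched f) := by by_cases ht : aliceTurn f <;> grind
    obtain ⟨i, hi⟩ := card_pos.1 hU
    obtain ⟨j⟩ := Fintype.card_pos_iff.1 (by have := hβ i; omega : 0 < Fintype.card (β i))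
    exact absurd hn (card_ne_zero_of_mem (mem_uncolored.2 (mem_untouched.1 hi j)))
  | succ n ih =>
    intro f hn hA hB
    have hU : 0 < #(untouched f) := by by_cases ht : aliceTurn f <;> grind
    rcases Nat.eq_zero_or_pos #(free f) with hF | hF
    · exact not_wins_of_isStuck (isStuck_of_free_eq_empty hF hU hβ)
    by_cases ht : aliceTurn f
    · have hA := hA ht
      refine not_wins_of_aliceTurn ht (by omega) fun f' h => ?_
      have ht' : ¬ aliceTurn f' := by rw [aliceTurn_of_gameMove h]; exact not_not.2 ht
      refine ih f' ?_ (fun h' => absurd h' ht') fun _ => ?_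
      · have := card_uncolored_of_gameMove h
        omega
      · rcases gameMove_cases h with h | h | ⟨i, h⟩
        · omega
        · omega
        · have := hβ i
          omega
    · have hB := hB ht
      obtain ⟨f', h, hf'⟩ : ∃ f', gameMove (SimpleGraph.completeMultipartiteGraph β) f f' ∧
          (#(free f') + 3 ≤ 2 * #(untouched f') ∨
            #(free f') + 2 ≤ 2 * #(untouched f') ∧ 2 ≤ #(pool f')) := by
        rcases Nat.eq_zero_or_pos #(pool f) with hT | hT
        · obtain ⟨i, hi⟩ := card_pos.1 hU
          have := hβ i
          obtain ⟨f', h, h'⟩ := exists_touch hi (by omega) hF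
          exact ⟨f', h, by omega⟩
        · obtain ⟨f', h, h'⟩ := exists_burn hT hF
          exact ⟨f', h, by omega⟩
      have ht' : aliceTurn f' := (aliceTurn_of_gameMove h).2 ht
      refine not_wins_of_not_aliceTurn ht h (ih f' ?_ (fun _ => hf') fun h' => absurd ht' h')
      have := card_uncolored_of_gameMove h
      omega

variable (β C) in
/-- The position without colored vertices. -/
abbrev start : (Σ i, β i) → Option C := fun _ => none

lemma uncolored_start : uncolored (start β C) = univ := by simp [uncolored]

lemma untouched_start : untouched (start β C) = univ := by simp [untouched]

lemma free_start : free (start β C) = univ := by simp [free]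

lemma card_pool_start : #(pool (start β C)) = 0 := by
  rw [card_eq_zero, eq_empty_iff_forall_notMem]
  intro v hv
  exact (mem_pool.1 hv).2 (by simp [untouched_start])

lemma proper_start : Proper (start β C) := fun _ _ _ h => by simp at h

lemma aliceTurn_start : aliceTurn (start β C) := by simp [aliceTurn]

lemma wins_start_iff :
    Wins (start β C) ↔ aliceWinsFrom (SimpleGraph.completeMultipartiteGraph β)
      (Fintype.card (Σ i, β i)) (start β C) := by
  rw [Wins, uncolored_start, card_univ]

/-- Bob wins if there are fewer than `2k - 2` colors for `k` parts. -/
lemma not_wins_start (hβ : ∀ i, 3 ≤ Fintype.card (β i))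
    (hC : Fintype.card C + 3 ≤ 2 * Fintype.card ι) : ¬ Wins (start β C) := by
  refine not_wins_of_card_free hβ _ _ rfl (fun _ => ?_) fun h => absurd aliceTurn_start h
  rw [free_start, untouched_start, card_univ, card_univ]
  exact .inl hC

/-- Alice wins with `2k - 2` colors by first touching a part of size three. -/
lemma wins_start (hβ : ∀ i, 3 ≤ Fintype.card (β i)) {i : ι} (hi : Fintype.card (β i) = 3)
    (hk : 3 ≤ Fintype.card ι) (hC : Fintype.card C + 2 = 2 * Fintype.card ι) :
    Wins (start β C) := by
  have hF : #(free (start β C)) = Fintype.card C := by rw [free_start, card_univ]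
  have hU : #(untouched (start β C)) = Fintype.card ι := by rw [untouched_start, card_univ]
  have hT := card_pool_start (β := β) (C := C)
  obtain ⟨f₁, h₁, n₁⟩ := exists_touch (f := start β C) (i := i) (by simp [untouched_start])
    (by omega) (by omega)
  have p₁ := proper_of_gameMove proper_start h₁
  have t₁ : ¬ aliceTurn f₁ := by
    rw [aliceTurn_of_gameMove h₁]
    exact not_not.2 aliceTurn_start
  refine wins_of_aliceTurn aliceTurn_start (not_isStuck_s13 proper_start (by omega)) h₁
    (wins_of_not_aliceTurn t₁ (not_isStuck_s13 p₁ (by omega)) fun f₂ h₂ => ?_)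
  have p₂ := proper_of_gameMove p₁ h₂
  have t₂ : aliceTurn f₂ := (aliceTurn_of_gameMove h₂).2 t₁
  rcases gameMove_cases h₂ with n₂ | n₂ | ⟨_, n₂⟩
  · refine wins_of_card_free hβ _ _ rfl p₂ (fun _ => ?_) fun h => absurd t₂ h
    omega
  · obtain ⟨f₃, h₃, n₃⟩ := exists_repeat p₂ (by omega)
    have p₃ := proper_of_gameMove p₂ h₃
    have t₃ : ¬ aliceTurn f₃ := by
      rw [aliceTurn_of_gameMove h₃]
      exact not_not.2 t₂
    refine wins_of_aliceTurn t₂ (not_isStuck_s13 p₂ (by omega)) h₃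
      (wins_of_not_aliceTurn t₃ (not_isStuck_s13 p₃ (by omega)) fun f₄ h₄ => ?_)
    have t₄ : aliceTurn f₄ := (aliceTurn_of_gameMove h₄).2 t₃
    refine wins_of_card_free hβ _ _ rfl (proper_of_gameMove p₃ h₄) (fun _ => ?_)
      fun h => absurd t₄ h
    rcases gameMove_cases h₄ with n₄ | n₄ | ⟨_, n₄⟩ <;> omega
  · refine wins_of_card_free hβ _ _ rfl p₂ (fun _ => ?_) fun h => absurd t₂ h
    omega

end

end MultipartiteGame

theorem game_chromatic_eq_of_min_three (k : ℕ) (hk : 3 ≤ k) (r : Fin k → ℕ)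
    (hanti : Antitone r) (hlast : r ⟨k - 1, by omega⟩ = 3) :
    gameChromaticNumber (K k r) = 2 * k - 2 := by
  have hβ : ∀ i : Fin k, 3 ≤ Fintype.card (Fin (r i)) := fun i => by
    rw [Fintype.card_fin, ← hlast]
    exact hanti (Fin.mk_le_mk.2 (by omega) : i ≤ ⟨k - 1, by omega⟩)
  refine IsLeast.csInf_eq ⟨?_, fun m hm => ?_⟩
  · exact MultipartiteGame.wins_start_iff.1 (MultipartiteGame.wins_start hβ
      (i := ⟨k - 1, by omega⟩) (by rw [Fintype.card_fin, hlast])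
      (by rwa [Fintype.card_fin]) (by simp only [Fintype.card_fin]; omega))
  · by_contra! h
    exact MultipartiteGame.not_wins_start (C := Fin m) hβ
      (by simp only [Fintype.card_fin]; omega) (MultipartiteGame.wins_start_iff.2 hm)
end

section
/- For every even k ≥ 4, the complete k-partite graph K_{2,2,1,…,1} (two parts of size 2 and k − 2 singleton parts) has game chromatic number χ_g(K_{2,2,1,…,1}) = k + 1. -/
open Finset

section General

variable {V C : Type}

/-- No two adjacent vertices share a color. -/
def IsProperPartial (G : SimpleGraph V) (f : V → Option C) : Prop :=
  ∀ v w c, G.Adj v w → f v = some c → f w ≠ some c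

lemma not_isFull_of_eq_none {f : V → Option C} {v : V} (hv : f v = none) : ¬ isFull f :=
  fun h => by simpa [hv] using h v

lemma exists_eq_none_of_not_isFull {f : V → Option C} (h : ¬ isFull f) : ∃ v, f v = none := by
  simpa [isFull] using h

lemma exists_legalColor_of_not_isStuck {G : SimpleGraph V} {f : V → Option C}
    (h : ¬ isStuck G f) {v : V} (hv : f v = none) : ∃ c, legalColor G f v c := by
  by_contra! hc
  exact h ⟨v, hv, hc⟩

lemma IsProperPartial.update [DecidableEq V] {G : SimpleGraph V} {f : V → Option C}
    (hf : IsProperPartial G f) {v : V} {c : C} (hc : legalColor G f v c) :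
    IsProperPartial G (Function.update f v (some c)) := by
  intro x y d hxy hx hy
  have hne := hxy.ne
  by_cases h1 : x = v
  · subst h1
    rw [Function.update_of_ne hne.symm] at hy
    simp only [Function.update_self, Option.some.injEq] at hx
    subst hx
    exact hc y hxy hy
  · rw [Function.update_of_ne h1] at hx
    by_cases h2 : y = v
    · subst h2
      simp only [Function.update_self, Option.some.injEq] at hy
      subst hy
      exact hc x hxy.symm hx
    · rw [Function.update_of_ne h2] at hy
      exact hf x y d hxy hx hy

variable [Fintype V]

/-- The vertices colored in a partial coloring. -/
def coloredVerts (f : V → Option C) : Finset V :=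
  univ.filter (fun v => (f v).isSome = true)

lemma aliceTurn_iff (f : V → Option C) : aliceTurn f ↔ Even (coloredVerts f).card := Iff.rfl

lemma card_coloredVerts_lt {f : V → Option C} {v : V} (hv : f v = none) :
    (coloredVerts f).card < Fintype.card V :=
  card_lt_univ_of_notMem (x := v) (by simp [coloredVerts, hv])

lemma isFull_of_card_le {f : V → Option C} (h : Fintype.card V ≤ (coloredVerts f).card) :
    isFull f := by
  intro v
  by_contra hv
  have := card_coloredVerts_lt (f := f) (v := v) (by simpa using hv)
  omega

/-- The colors used in a partial coloring. -/
def usedColors [Fintype C] [DecidableEq C] (f : V → Option C) : Finset C := univ.filter (fun c => ∃ v, f v = some c)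

lemma card_usedColors_le [Fintype C] [DecidableEq C] (f : V → Option C) :
    (usedColors f).card ≤ (coloredVerts f).card := by
  rw [← card_map Function.Embedding.some]
  refine (card_le_card ?_).trans (card_image_le (f := f))
  intro x hx
  simp only [usedColors, mem_map, mem_filter, mem_univ, true_and,
    Function.Embedding.some_apply] at hx
  obtain ⟨c, ⟨v, hv⟩, rfl⟩ := hx
  exact mem_image.2 ⟨v, by simp [coloredVerts, hv], hv⟩

lemma not_isStuck_of_card_lt [Fintype C] [DecidableEq C] (G : SimpleGraph V) {f : V → Option C}
    (h : (usedColors f).card < Fintype.card C) : ¬ isStuck G f := by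
  rintro ⟨v, -, hv⟩
  obtain ⟨c, hc⟩ : ∃ c, c ∉ usedColors f := by
    by_contra! hall
    rw [eq_univ_iff_forall.2 hall, card_univ] at h
    exact lt_irrefl _ h
  exact hv c fun w _ hw => hc (by simpa [usedColors] using ⟨w, hw⟩)

variable [DecidableEq V]

lemma card_coloredVerts_update {f : V → Option C} {v : V} (c : C) (hv : f v = none) :
    (coloredVerts (Function.update f v (some c))).card = (coloredVerts f).card + 1 := by
  have h : coloredVerts (Function.update f v (some c)) = insert v (coloredVerts f) := by
    ext w
    by_cases hw : w = v
    · subst hw; simp [coloredVerts]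
    · simp [coloredVerts, hw]
  rw [h, card_insert_of_notMem]
  simp [coloredVerts, hv]

lemma aliceTurn_update {f : V → Option C} {v : V} (c : C) (hv : f v = none) :
    aliceTurn (Function.update f v (some c)) ↔ ¬ aliceTurn f := by
  rw [aliceTurn_iff, aliceTurn_iff, card_coloredVerts_update c hv, Nat.even_add_one]

/-- Alice wins from any position in a class of non-stuck positions closed under all moves. -/
lemma aliceWinsFrom_of_closed {G : SimpleGraph V} (P : (V → Option C) → Prop)
    (hmove : ∀ f v c, P f → f v = none → legalColor G f v c → P (Function.update f v (some c)))
    (hstuck : ∀ f, P f → ¬ isStuck G f) (n : ℕ) (f : V → Option C) (hf : P f)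
    (hn : Fintype.card V ≤ (coloredVerts f).card + n) : aliceWinsFrom G n f := by
  induction n generalizing f with
  | zero => exact isFull_of_card_le hn
  | succ n ih =>
    by_cases hfull : isFull f
    · exact Or.inl hfull
    · refine Or.inr ⟨hstuck f hf, ?_⟩
      have key : ∀ f', gameMove G f f' → aliceWinsFrom G n f' := by
        rintro f' ⟨v, c, hv, hc, rfl⟩
        exact ih _ (hmove f v c hf hv hc) (by rw [card_coloredVerts_update c hv]; omega)
      by_cases ht : aliceTurn f
      · obtain ⟨v, hv⟩ := exists_eq_none_of_not_isFull hfull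
        obtain ⟨c, hc⟩ := exists_legalColor_of_not_isStuck (hstuck f hf) hv
        have hm : gameMove G f (Function.update f v (some c)) := ⟨v, c, hv, hc, rfl⟩
        exact Or.inl ⟨ht, _, hm, key _ hm⟩
      · exact Or.inr ⟨ht, key⟩

/-- Alice does not win from any position in a class of non-full positions closed under all
moves. -/
lemma not_aliceWinsFrom_of_closed {G : SimpleGraph V} (P : (V → Option C) → Prop)
    (hmove : ∀ f v c, P f → f v = none → legalColor G f v c → P (Function.update f v (some c)))
    (hfull : ∀ f, P f → ¬ isFull f) (n : ℕ) (f : V → Option C) (hf : P f) :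
    ¬ aliceWinsFrom G n f := by
  induction n generalizing f with
  | zero => exact hfull f hf
  | succ n ih =>
    rintro (h | ⟨hs, ⟨-, f', ⟨v, c, hv, hc, rfl⟩, hw⟩ | ⟨-, h⟩⟩)
    · exact hfull f hf h
    · exact ih _ (hmove f v c hf hv hc) hw
    · obtain ⟨v, hv⟩ := exists_eq_none_of_not_isFull (hfull f hf)
      obtain ⟨c, hc⟩ := exists_legalColor_of_not_isStuck hs hv
      exact ih _ (hmove f v c hf hv hc) (h _ ⟨v, c, hv, hc, rfl⟩)

lemma usedColors_update [Fintype C] [DecidableEq C] {f : V → Option C} {v : V} (c : C)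
    (hv : f v = none) : usedColors (Function.update f v (some c)) = insert c (usedColors f) := by
  ext d
  simp only [usedColors, mem_filter, mem_univ, true_and, mem_insert]
  constructor
  · rintro ⟨w, hw⟩
    by_cases h : w = v
    · subst h; left; simpa [eq_comm] using hw
    · rw [Function.update_of_ne h] at hw
      exact Or.inr ⟨w, hw⟩
  · rintro (rfl | ⟨w, hw⟩)
    · exact ⟨v, by simp⟩
    · refine ⟨w, ?_⟩
      rwa [Function.update_of_ne]
      rintro rfl
      simp [hv] at hw

end General

section Multipartite

variable {k : ℕ} {r : Fin k → ℕ} {C : Type}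

lemma K_adj {v w : Σ i : Fin k, Fin (r i)} : (K k r).Adj v w ↔ v.1 ≠ w.1 := Iff.rfl

/-- The parts none of whose vertices is colored. -/
def untouchedParts (f : (Σ i : Fin k, Fin (r i)) → Option C) : Finset (Fin k) :=
  univ.filter (fun i => ∀ w : Σ i : Fin k, Fin (r i), w.1 = i → f w = none)

lemma mem_untouchedParts {f : (Σ i : Fin k, Fin (r i)) → Option C} {i : Fin k} :
    i ∈ untouchedParts f ↔ ∀ w : Σ i : Fin k, Fin (r i), w.1 = i → f w = none := by
  simp [untouchedParts]

lemma untouchedParts_update (f : (Σ i : Fin k, Fin (r i)) → Option C)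
    (v : Σ i : Fin k, Fin (r i)) (c : C) :
    untouchedParts (Function.update f v (some c)) = (untouchedParts f).erase v.1 := by
  ext i
  simp only [mem_untouchedParts, mem_erase]
  constructor
  · intro h
    refine ⟨fun hi => by simpa using h v hi.symm, fun w hw => ?_⟩
    have hwv : w ≠ v := fun e => by subst e; simpa using h w hw
    simpa [hwv] using h w hw
  · rintro ⟨hi, h⟩ w hw
    have hwv : w ≠ v := fun e => hi (by rw [← hw, e])
    simpa [hwv] using h w hw

variable [Fintype C] [DecidableEq C]

/-- A legal color at a vertex of an untouched part is a new color. -/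
lemma notMem_usedColors_of_legalColor {f : (Σ i : Fin k, Fin (r i)) → Option C}
    {v : Σ i : Fin k, Fin (r i)} {c : C} (hp : v.1 ∈ untouchedParts f)
    (hc : legalColor (K k r) f v c) : c ∉ usedColors f := by
  simp only [usedColors, mem_filter, mem_univ, true_and, not_exists]
  intro w hw
  by_cases h : w.1 = v.1
  · simp [mem_untouchedParts.1 hp w h] at hw
  · exact hc w (K_adj.2 (Ne.symm h)) hw

/-- The number of used colors plus the number of untouched parts never decreases. -/
lemma card_used_add_untouched_le_update {f : (Σ i : Fin k, Fin (r i)) → Option C}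
    {v : Σ i : Fin k, Fin (r i)} {c : C} (hv : f v = none)
    (hc : legalColor (K k r) f v c) :
    (usedColors f).card + (untouchedParts f).card ≤
      (usedColors (Function.update f v (some c))).card +
        (untouchedParts (Function.update f v (some c))).card := by
  rw [usedColors_update c hv, untouchedParts_update]
  by_cases hp : v.1 ∈ untouchedParts f
  · rw [card_insert_of_notMem (notMem_usedColors_of_legalColor hp hc), card_erase_of_mem hp]
    omega
  · rw [erase_eq_of_notMem hp]
    exact Nat.add_le_add_right (card_le_card (subset_insert _ _)) _

/-- Bob wins once there are fewer unused colors than untouched parts. -/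
lemma not_aliceWinsFrom_of_card_lt (hr : ∀ i, 0 < r i) (n : ℕ)
    (f : (Σ i : Fin k, Fin (r i)) → Option C)
    (hf : Fintype.card C < (usedColors f).card + (untouchedParts f).card) :
    ¬ aliceWinsFrom (K k r) n f := by
  refine not_aliceWinsFrom_of_closed
    (fun f => Fintype.card C < (usedColors f).card + (untouchedParts f).card)
    (fun f v c h hv hc => h.trans_le (card_used_add_untouched_le_update hv hc)) ?_ n f hf
  intro f h hfull
  have h0 : untouchedParts f = ∅ := by
    rw [eq_empty_iff_forall_notMem]
    intro i hi
    exact not_isFull_of_eq_none (mem_untouchedParts.1 hi ⟨i, ⟨0, hr i⟩⟩ rfl) hfull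
  rw [h0, card_empty, add_zero] at h
  exact absurd (card_le_univ (usedColors f)) (not_le.2 h)

end Multipartite

section K221

/-- The part sizes of `K_{2,2,1,…,1}`. -/
abbrev sizes221 (k : ℕ) : Fin k → ℕ := fun i => if (i : ℕ) < 2 then 2 else 1

/-- The vertices of `K_{2,2,1,…,1}`. -/
abbrev Vert221 (k : ℕ) : Type := Σ i : Fin k, Fin (sizes221 k i)

lemma exists_ne_same_part {k : ℕ} (v : Vert221 k) (hv : (v.1 : ℕ) < 2) :
    ∃ w : Vert221 k, w ≠ v ∧ w.1 = v.1 := by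
  obtain ⟨i, j⟩ := v
  have : Nontrivial (Fin (sizes221 k i)) :=
    Fin.nontrivial_iff_two_le.2 (by simp only [sizes221]; rw [if_pos hv])
  obtain ⟨j', hj⟩ := exists_ne j
  exact ⟨⟨i, j'⟩, fun h => hj (by simpa using h), rfl⟩

lemma exists_other_double {k : ℕ} (hk : 2 ≤ k) (i : Fin k) :
    ∃ j : Fin k, j ≠ i ∧ (j : ℕ) < 2 := by
  by_cases h : (i : ℕ) = 0
  · exact ⟨⟨1, by omega⟩, fun e => by simp [← e] at h, by simp⟩
  · exact ⟨⟨0, by omega⟩, fun e => h (by simp [← e]), by simp⟩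

lemma sizes221_pos (k : ℕ) (i : Fin k) : 0 < sizes221 k i := by
  simp only [sizes221]; split_ifs <;> simp

lemma card_vert221 {k : ℕ} (hk : 2 ≤ k) : Fintype.card (Vert221 k) = k + 2 := by
  obtain ⟨l, rfl⟩ := Nat.exists_eq_add_of_le' hk
  simp [Fintype.card_sigma, Fin.sum_univ_succ, sizes221]
  omega

lemma card_singles221 {k : ℕ} (hk : 2 ≤ k) :
    (univ.filter (fun v : Vert221 k => ¬ (v.1 : ℕ) < 2)).card = k - 2 := by
  obtain ⟨l, rfl⟩ := Nat.exists_eq_add_of_le' hk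
  rw [card_filter, Fintype.sum_sigma]
  simp [Fin.sum_univ_succ, sizes221]

variable {k : ℕ} {C : Type}

/-- At most `k` vertices are colored while a part of size two is untouched. -/
lemma card_coloredVerts_le_of_untouched (hk : 2 ≤ k) {f : Vert221 k → Option C} {i : Fin k}
    (hi : (i : ℕ) < 2) (h : i ∈ untouchedParts f) : (coloredVerts f).card ≤ k := by
  let v : Vert221 k := ⟨i, ⟨0, sizes221_pos k i⟩⟩
  obtain ⟨w, hwv, hw⟩ := exists_ne_same_part v hi
  have hsub : coloredVerts f ⊆ univ \ {v, w} := by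
    intro x hx
    simp only [coloredVerts, mem_filter, mem_univ, true_and] at hx
    simp only [mem_sdiff, mem_univ, true_and, mem_insert, mem_singleton, not_or]
    constructor <;> rintro rfl
    · simp [mem_untouchedParts.1 h v rfl] at hx
    · simp [mem_untouchedParts.1 h x hw] at hx
  have h1 := card_le_card hsub
  rw [card_sdiff_of_subset (subset_univ _), card_univ, card_vert221 hk,
    card_pair hwv.symm] at h1
  omega

variable [Fintype C] [DecidableEq C]

lemma not_isStuck_of_untouched (hk : 2 ≤ k) (hC : Fintype.card C = k + 1)
    {f : Vert221 k → Option C} {i : Fin k}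
    (hi : (i : ℕ) < 2) (h : i ∈ untouchedParts f) : ¬ isStuck (K k (sizes221 k)) f := by
  have := card_coloredVerts_le_of_untouched hk hi h
  have := card_usedColors_le f
  exact not_isStuck_of_card_lt _ (by omega)

/-- With `k + 1` colors, Alice wins once some color has been repeated. -/
lemma aliceWinsFrom_of_card_lt (hk : 2 ≤ k) (hC : Fintype.card C = k + 1) (n : ℕ)
    (f : Vert221 k → Option C) (hf : (usedColors f).card < (coloredVerts f).card)
    (hn : Fintype.card (Vert221 k) ≤ (coloredVerts f).card + n) :
    aliceWinsFrom (K k (sizes221 k)) n f := by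
  refine aliceWinsFrom_of_closed (fun f => (usedColors f).card < (coloredVerts f).card)
    ?_ ?_ n f hf hn
  · intro f v c h hv _
    rw [usedColors_update c hv, card_coloredVerts_update c hv]
    have := card_insert_le c (usedColors f)
    omega
  · intro f h hs
    obtain ⟨v, hv, -⟩ := id hs
    have h1 := card_coloredVerts_lt hv
    rw [card_vert221 hk] at h1
    exact not_isStuck_of_card_lt _ (by omega) hs

/-- With `k + 1` colors, Alice wins once all singleton parts are colored. -/
lemma aliceWinsFrom_of_singles_colored (hk : 2 ≤ k) (hC : Fintype.card C = k + 1) (n : ℕ)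
    (f : Vert221 k → Option C) (hp : IsProperPartial (K k (sizes221 k)) f)
    (hf : ∀ v : Vert221 k, ¬ (v.1 : ℕ) < 2 → f v ≠ none)
    (hn : Fintype.card (Vert221 k) ≤ (coloredVerts f).card + n) :
    aliceWinsFrom (K k (sizes221 k)) n f := by
  refine aliceWinsFrom_of_closed (fun f => IsProperPartial (K k (sizes221 k)) f ∧
    ∀ v : Vert221 k, ¬ (v.1 : ℕ) < 2 → f v ≠ none) ?_ ?_ n f ⟨hp, hf⟩ hn
  · rintro f v c ⟨h1, h2⟩ hv hc
    refine ⟨h1.update hc, fun w hw => ?_⟩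
    by_cases h : w = v
    · subst h; simp
    · rw [Function.update_of_ne h]; exact h2 w hw
  · rintro f ⟨h1, h2⟩ hs
    obtain ⟨v, hv, hvs⟩ := id hs
    have hv2 : (v.1 : ℕ) < 2 := by
      by_contra h
      exact h2 v h hv
    by_cases hu : v.1 ∈ untouchedParts f
    · exact not_isStuck_of_untouched hk hC hv2 hu hs
    · rw [mem_untouchedParts] at hu
      push Not at hu
      obtain ⟨w, hw, hfw⟩ := hu
      obtain ⟨c, hc⟩ := Option.ne_none_iff_exists'.1 hfw
      exact hvs c fun x hx => h1 w x c (by rw [K_adj] at hx ⊢; rwa [hw]) hc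

/-- With `k + 1` colors, Alice wins on her turn while both parts of size two are untouched. -/
lemma aliceWinsFrom_of_doubles_untouched (hk : 2 ≤ k) (hC : Fintype.card C = k + 1) (n : ℕ)
    (f : Vert221 k → Option C) (ht : aliceTurn f) (hp : IsProperPartial (K k (sizes221 k)) f)
    (hf : ∀ i : Fin k, (i : ℕ) < 2 → i ∈ untouchedParts f)
    (hn : Fintype.card (Vert221 k) ≤ (coloredVerts f).card + n) :
    aliceWinsFrom (K k (sizes221 k)) n f := by
  induction n using Nat.strong_induction_on generalizing f with
  | _ n ih =>
  by_cases hall : ∀ v : Vert221 k, ¬ (v.1 : ℕ) < 2 → f v ≠ none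
  · exact aliceWinsFrom_of_singles_colored hk hC n f hp hall hn
  push Not at hall
  obtain ⟨v, hv2, hv⟩ := hall
  replace hv2 : ¬ (v.1 : ℕ) < 2 := not_lt.2 hv2
  obtain ⟨i, -, hi⟩ := exists_other_double hk v.1
  have hcard := card_coloredVerts_le_of_untouched hk hi (hf i hi)
  have hstuck := not_isStuck_of_untouched hk hC hi (hf i hi)
  obtain ⟨c, hc⟩ := exists_legalColor_of_not_isStuck hstuck hv
  have hV := card_vert221 hk
  obtain ⟨n, rfl⟩ : ∃ n', n = n' + 2 := ⟨n - 2, by omega⟩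
  refine Or.inr ⟨hstuck, Or.inl ⟨ht, _, ⟨v, c, hv, hc, rfl⟩, ?_⟩⟩
  have hp1 := hp.update hc
  have hf1 : ∀ i : Fin k, (i : ℕ) < 2 →
      i ∈ untouchedParts (Function.update f v (some c)) := by
    intro i hi
    rw [untouchedParts_update]
    exact mem_erase.2 ⟨fun h => hv2 (h ▸ hi), hf i hi⟩
  have ht1 : ¬ aliceTurn (Function.update f v (some c)) := by
    rw [aliceTurn_update c hv]; exact not_not.2 ht
  have hn1 := card_coloredVerts_update c hv
  generalize Function.update f v (some c) = g at *
  refine Or.inr ⟨not_isStuck_of_untouched hk hC hi (hf1 i hi), Or.inr ⟨ht1, ?_⟩⟩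
  rintro _ ⟨w, d, hw, hd, rfl⟩
  have hp2 := hp1.update hd
  have ht2 := (aliceTurn_update d hw).2 ht1
  have hn2 := card_coloredVerts_update d hw
  by_cases hw2 : (w.1 : ℕ) < 2
  · obtain ⟨x, hxw, hx⟩ := exists_ne_same_part w hw2
    obtain ⟨j, hjw, hj⟩ := exists_other_double hk w.1
    have hju : j ∈ untouchedParts (Function.update g w (some d)) := by
      rw [untouchedParts_update]
      exact mem_erase.2 ⟨hjw, hf1 j hj⟩
    have hxn : Function.update g w (some d) x = none := by
      rw [Function.update_of_ne hxw]
      exact mem_untouchedParts.1 (hf1 _ hw2) x hx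
    have hle := card_coloredVerts_le_of_untouched hk hj hju
    obtain ⟨n, rfl⟩ : ∃ n', n = n' + 1 := ⟨n - 1, by omega⟩
    refine Or.inr ⟨not_isStuck_of_untouched hk hC hj hju,
      Or.inl ⟨ht2, _, ⟨x, d, hxn, ?_, rfl⟩, ?_⟩⟩
    · intro y hy
      exact hp2 w y d (by rw [K_adj] at hy ⊢; rwa [← hx]) (by simp)
    · refine aliceWinsFrom_of_card_lt hk hC n _ ?_ ?_
      · rw [usedColors_update d hxn, card_coloredVerts_update d hxn, insert_eq_of_mem]
        · exact Nat.lt_succ_of_le (card_usedColors_le _)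
        · rw [usedColors_update d hw]; exact mem_insert_self _ _
      · rw [card_coloredVerts_update d hxn]; omega
  · refine ih n (by omega) _ ht2 hp2 ?_ (by omega)
    intro i hi
    rw [untouchedParts_update]
    exact mem_erase.2 ⟨fun h => hw2 (h ▸ hi), hf1 i hi⟩

/-- With at most as many unused colors as untouched parts, Bob wins on Alice's turn while both
parts of size two are untouched. -/
lemma not_aliceWinsFrom_of_doubles_untouched (hk : 2 ≤ k) (hke : Even k) (n : ℕ)
    (f : Vert221 k → Option C) (ht : aliceTurn f)
    (hf : ∀ i : Fin k, (i : ℕ) < 2 → i ∈ untouchedParts f)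
    (hle : Fintype.card C ≤ (usedColors f).card + (untouchedParts f).card) :
    ¬ aliceWinsFrom (K k (sizes221 k)) n f := by
  induction n using Nat.strong_induction_on generalizing f with
  | _ n ih =>
  have not_full : ∀ (g : Vert221 k → Option C) (i : Fin k), i ∈ untouchedParts g →
      ¬ isFull g := fun g i hi =>
    not_isFull_of_eq_none (mem_untouchedParts.1 hi ⟨i, ⟨0, sizes221_pos k i⟩⟩ rfl)
  have hd : ((⟨0, by omega⟩ : Fin k) : ℕ) < 2 := by simp
  cases n with
  | zero => exact not_full f _ (hf _ hd)
  | succ n =>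
  rintro (h | ⟨-, ⟨-, f', ⟨v, c, hv, hc, rfl⟩, hwin⟩ | ⟨h, -⟩⟩)
  · exact not_full f _ (hf _ hd) h
  swap
  · exact h ht
  have hle1 := hle.trans (card_used_add_untouched_le_update hv hc)
  have ht1 : ¬ aliceTurn (Function.update f v (some c)) := by
    rw [aliceTurn_update c hv]; exact not_not.2 ht
  obtain ⟨j, hjv, hj⟩ := exists_other_double hk v.1
  have hju : j ∈ untouchedParts (Function.update f v (some c)) := by
    rw [untouchedParts_update]; exact mem_erase.2 ⟨hjv, hf j hj⟩
  cases n with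
  | zero => exact not_full _ _ hju hwin
  | succ n =>
  rcases hwin with h | ⟨hs, ⟨h, -⟩ | ⟨-, hbob⟩⟩
  · exact not_full _ _ hju h
  · exact ht1 h
  by_cases hv2 : (v.1 : ℕ) < 2
  · obtain ⟨x, hxv, hx⟩ := exists_ne_same_part v hv2
    have hxn : Function.update f v (some c) x = none := by
      rw [Function.update_of_ne hxv]
      exact mem_untouchedParts.1 (hf _ hv2) x hx
    obtain ⟨d, hd⟩ := exists_legalColor_of_not_isStuck hs
      (mem_untouchedParts.1 hju ⟨j, ⟨0, sizes221_pos k j⟩⟩ rfl)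
    have hdn := notMem_usedColors_of_legalColor (by exact hju) hd
    refine not_aliceWinsFrom_of_card_lt (sizes221_pos k) n _ ?_ (hbob _ ⟨x, d, hxn, ?_, rfl⟩)
    · have hxu : x.1 ∉ untouchedParts (Function.update f v (some c)) := by
        rw [untouchedParts_update, hx]; exact notMem_erase _ _
      rw [usedColors_update d hxn, untouchedParts_update _ x, erase_eq_of_notMem hxu,
        card_insert_of_notMem hdn]
      omega
    · intro y _ hy
      exact hdn (by simpa only [usedColors, mem_filter, mem_univ, true_and] using ⟨y, hy⟩)
  · have hf1 : ∀ i : Fin k, (i : ℕ) < 2 →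
        i ∈ untouchedParts (Function.update f v (some c)) := by
      intro i hi
      rw [untouchedParts_update]
      exact mem_erase.2 ⟨fun h => hv2 (h ▸ hi), hf i hi⟩
    generalize Function.update f v (some c) = g at *
    obtain ⟨w, hw2, hw⟩ : ∃ w : Vert221 k, ¬ (w.1 : ℕ) < 2 ∧ g w = none := by
      by_contra! hall
      apply ht1
      have he : coloredVerts g = univ.filter (fun v : Vert221 k => ¬ (v.1 : ℕ) < 2) := by
        ext w
        simp only [coloredVerts, mem_filter, mem_univ, true_and]
        constructor
        · intro h h2
          simp [mem_untouchedParts.1 (hf1 _ h2) w rfl] at h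
        · intro h
          exact Option.isSome_iff_ne_none.2 (hall w (not_lt.1 h))
      rw [aliceTurn_iff, he, card_singles221 hk]
      exact hke.tsub even_two
    obtain ⟨d, hd⟩ := exists_legalColor_of_not_isStuck hs hw
    refine ih n (by omega) _ ((aliceTurn_update d hw).2 ht1) ?_
      (hle1.trans (card_used_add_untouched_le_update hw hd)) (hbob _ ⟨w, d, hw, hd, rfl⟩)
    intro i hi
    rw [untouchedParts_update]
    exact mem_erase.2 ⟨fun h => hw2 (h ▸ hi), hf1 i hi⟩

end K221

theorem game_chromatic_K221s (k : ℕ) (hk : 4 ≤ k) (hke : Even k) :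
    gameChromaticNumber (K k (fun i => if (i : ℕ) < 2 then 2 else 1)) = k + 1 := by
  have hk2 : 2 ≤ k := by omega
  have hturn : ∀ m, aliceTurn (fun _ : Vert221 k => (none : Option (Fin m))) := by
    intro m; simp [aliceTurn]
  have huntouched : ∀ m, untouchedParts (fun _ : Vert221 k => (none : Option (Fin m))) = univ := by
    intro m; simp [untouchedParts]
  have hmem : k + 1 ∈ {m | aliceWins (K k (sizes221 k)) m} := by
    refine aliceWinsFrom_of_doubles_untouched hk2 (by simp) _ _ (hturn _) ?_ ?_ (Nat.le_add_left _ _)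
    · intro v w c _ h
      simp at h
    · intro i _
      rw [huntouched]; exact mem_univ i
  refine le_antisymm (Nat.sInf_le hmem) (le_csInf ⟨_, hmem⟩ ?_)
  intro m hm
  by_contra! hlt
  refine not_aliceWinsFrom_of_doubles_untouched hk2 hke _ _ (hturn m) ?_ ?_ hm
  · intro i _
    rw [huntouched]; exact mem_univ i
  · rw [huntouched, card_univ, Fintype.card_fin, Fintype.card_fin]
    omega
end
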